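/- For every t ≥ 0 and every x ∈ ℝ, the derivative of the flow with respect to the initial value satisfies |∂_x Φ_t(x)| ≤ exp(t); consequently, for all x, y ∈ ℝ one has |Φ_t(x) − Φ_t(y)| ≤ exp(t)·|x − y|. -/

import Mathlib

/-- `D t x = x² + (1 − x²)·exp(−2t)`. -/
noncomputable def D (t x : ℝ) : ℝ := x ^ 2 + (1 - x ^ 2) * Real.exp (-2 * t)

/-- The flow `Φ_t(x) = x / √(D t x)` of the ODE `x' = x − x³`. -/
noncomputable def Phi (t x : ℝ) : ℝ := x / Real.sqrt (D t x)

lemma exp_neg_two_mul_le_D {t : ℝ} (ht : 0 ≤ t) (x : ℝ) : Real.exp (-2 * t) ≤ D t x := by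
  have h : Real.exp (-2 * t) ≤ 1 := Real.exp_le_one_iff.2 (by linarith)
  have := mul_nonneg (sq_nonneg x) (sub_nonneg.2 h)
  unfold D
  linarith

lemma D_pos {t : ℝ} (ht : 0 ≤ t) (x : ℝ) : 0 < D t x :=
  (Real.exp_pos _).trans_le (exp_neg_two_mul_le_D ht x)

lemma exp_neg_le_sqrt_D {t : ℝ} (ht : 0 ≤ t) (x : ℝ) : Real.exp (-t) ≤ √(D t x) := by
  apply Real.le_sqrt_of_sq_le
  have h : Real.exp (-t) ^ 2 = Real.exp (-2 * t) := by
    rw [← Real.exp_nat_mul]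
    congr 1
    push_cast
    ring
  exact h ▸ exp_neg_two_mul_le_D ht x

lemma hasDerivAt_D (t x : ℝ) :
    HasDerivAt (D t) (2 * x * (1 - Real.exp (-2 * t))) x := by
  have h := hasDerivAt_pow 2 x
  refine (h.add ((h.const_sub 1).mul_const (Real.exp (-2 * t)))).congr_deriv ?_
  simp only [Nat.cast_ofNat, Nat.add_one_sub_one, pow_one]
  ring

lemma hasDerivAt_Phi {t : ℝ} (ht : 0 ≤ t) (x : ℝ) :
    HasDerivAt (Phi t) (Real.exp (-2 * t) / (D t x * √(D t x))) x := by
  have hD := D_pos ht x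
  have hs := Real.sqrt_pos.2 hD
  have hsq := Real.sq_sqrt hD.le
  refine ((hasDerivAt_id x).div ((hasDerivAt_D t x).sqrt hD.ne') hs.ne').congr_deriv ?_
  rw [hsq, id]
  field_simp
  rw [hsq, D, neg_mul]
  ring

lemma abs_deriv_Phi_le {t : ℝ} (ht : 0 ≤ t) (x : ℝ) : |deriv (Phi t) x| ≤ Real.exp t := by
  have hD := D_pos ht x
  have hs := Real.sqrt_pos.2 hD
  rw [(hasDerivAt_Phi ht x).deriv, abs_of_nonneg (by positivity), div_le_iff₀ (by positivity)]
  calc Real.exp (-2 * t) ≤ D t x := exp_neg_two_mul_le_D ht x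
    _ = D t x * (Real.exp t * Real.exp (-t)) := by simp [← Real.exp_add]
    _ ≤ D t x * (Real.exp t * √(D t x)) := by
      gcongr
      exact exp_neg_le_sqrt_D ht x
    _ = Real.exp t * (D t x * √(D t x)) := by ring

/-- `|∂_x Φ_t(x)| ≤ exp(t)`, hence `Φ_t` is `exp(t)`-Lipschitz. -/
theorem phi_deriv_bound_and_lipschitz (t : ℝ) (ht : 0 ≤ t) :
    (∀ x : ℝ, |deriv (fun y => Phi t y) x| ≤ Real.exp t) ∧
    (∀ x y : ℝ, |Phi t x - Phi t y| ≤ Real.exp t * |x - y|) := by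
  refine ⟨abs_deriv_Phi_le ht, fun x y => ?_⟩
  exact convex_univ.norm_image_sub_le_of_norm_deriv_le
    (fun z _ => (hasDerivAt_Phi ht z).differentiableAt) (fun z _ => abs_deriv_Phi_le ht z)
    (Set.mem_univ y) (Set.mem_univ x)
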